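/- arXiv:1410.6442 — 8 statements merged into one kernel-verified Lean document; each statement's English description precedes it below -/
import Mathlib

section
/- Let A, B, C be three non-collinear points in the Euclidean plane ℝ² forming an equilateral triangle (dist A B = dist B C = dist C A). Then for every point P in the convex hull of {A, B, C}, the sum of the distances from P to the three side-lines, dist(P, line AB) + dist(P, line BC) + dist(P, line CA), equals the height of the triangle, i.e. equals dist(A, line BC). -/
noncomputable def lineDist (P A B : EuclideanSpace ℝ (Fin 2)) : ℝ :=
  Metric.infDist P (affineSpan ℝ {A, B} : Set (EuclideanSpace ℝ (Fin 2)))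

noncomputable def distSum (A B C P : EuclideanSpace ℝ (Fin 2)) : ℝ :=
  lineDist P A B + lineDist P B C + lineDist P C A

/-- The signed area of the parallelogram spanned by `B - A` and `P - A`. -/
def cross (A B P : EuclideanSpace ℝ (Fin 2)) : ℝ :=
  (B 0 - A 0) * (P 1 - A 1) - (B 1 - A 1) * (P 0 - A 0)

lemma dist_sq_eq_coord (X Y : EuclideanSpace ℝ (Fin 2)) :
    dist X Y ^ 2 = (X 0 - Y 0) ^ 2 + (X 1 - Y 1) ^ 2 := by
  rw [EuclideanSpace.dist_eq, Real.sq_sqrt (by positivity), Fin.sum_univ_two,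
    Real.dist_eq, Real.dist_eq, sq_abs, sq_abs]

lemma lineMap_coord (A B : EuclideanSpace ℝ (Fin 2)) (t : ℝ) (i : Fin 2) :
    AffineMap.lineMap A B t i = t * (B i - A i) + A i := by
  simp [AffineMap.lineMap_apply]

lemma dist_mul_lineDist {A B : EuclideanSpace ℝ (Fin 2)} (h : A ≠ B)
    (P : EuclideanSpace ℝ (Fin 2)) : dist A B * lineDist P A B = |cross A B P| := by
  have hd : 0 < dist A B := dist_pos.2 h
  have hd2 : 0 < dist A B ^ 2 := by positivity
  rw [mul_comm, ← eq_div_iff hd.ne']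
  refine le_antisymm ?_ ?_
  · set t : ℝ := ((P 0 - A 0) * (B 0 - A 0) + (P 1 - A 1) * (B 1 - A 1)) / dist A B ^ 2
      with ht
    refine (Metric.infDist_le_dist_of_mem
      (SetLike.mem_coe.2 (AffineMap.lineMap_mem_affineSpan_pair t A B))).trans ?_
    rw [le_div_iff₀ hd]
    refine (sq_le_sq₀ (by positivity) (abs_nonneg _)).1 ?_
    have ht' := (eq_div_iff hd2.ne').1 ht
    rw [sq_abs, mul_pow, dist_sq_eq_coord P, lineMap_coord, lineMap_coord]
    rw [dist_sq_eq_coord A B] at ht' ⊢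
    unfold cross
    apply le_of_eq
    linear_combination (t * ((A 0 - B 0) ^ 2 + (A 1 - B 1) ^ 2) -
      ((P 0 - A 0) * (B 0 - A 0) + (P 1 - A 1) * (B 1 - A 1))) * ht'
  · refine (Metric.le_infDist ⟨A, left_mem_affineSpan_pair ℝ A B⟩).2 fun Q hQ => ?_
    obtain ⟨s, rfl⟩ := mem_affineSpan_pair_iff_exists_lineMap_eq.1 hQ
    rw [div_le_iff₀ hd]
    refine abs_le_of_sq_le_sq ?_ (by positivity)
    rw [mul_pow, dist_sq_eq_coord P, dist_sq_eq_coord A, lineMap_coord, lineMap_coord]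
    unfold cross
    nlinarith [sq_nonneg ((P 0 - (s * (B 0 - A 0) + A 0)) * (B 0 - A 0) +
      (P 1 - (s * (B 1 - A 1) + A 1)) * (B 1 - A 1))]

theorem viviani (A B C : EuclideanSpace ℝ (Fin 2))
    (hncol : ¬ Collinear ℝ ({A, B, C} : Set (EuclideanSpace ℝ (Fin 2))))
    (hAB : dist A B = dist B C) (hBC : dist B C = dist C A) :
    ∀ P ∈ convexHull ℝ ({A, B, C} : Set (EuclideanSpace ℝ (Fin 2))),
      distSum A B C P = lineDist A B C := by
  intro P hP
  have hne : A ≠ B := by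
    rintro rfl
    exact hncol (by simpa using collinear_pair ℝ A C)
  have hd : 0 < dist A B := dist_pos.2 hne
  have hBC' : B ≠ C := dist_pos.1 (hAB ▸ hd)
  have hCA' : C ≠ A := dist_pos.1 (hBC ▸ hAB ▸ hd)
  have h₁ := dist_mul_lineDist hne P
  have h₂ := dist_mul_lineDist hBC' P
  have h₃ := dist_mul_lineDist hCA' P
  have h₄ := dist_mul_lineDist hBC' A
  rw [← hBC, ← hAB] at h₃
  rw [← hAB] at h₂ h₄
  apply mul_left_cancel₀ hd.ne'
  rw [distSum, mul_add, mul_add, h₁, h₂, h₃, h₄]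
  rw [convexHull_insert (Set.insert_nonempty _ _), convexHull_pair, mem_convexJoin] at hP
  obtain ⟨X, hX, Q, ⟨a, b, ha, hb, hab, rfl⟩, c, d, hc, hd', hcd, rfl⟩ := hP
  rw [Set.mem_singleton_iff.1 hX]
  obtain rfl : a = 1 - b := by linarith
  obtain rfl : c = 1 - d := by linarith
  have e₁ : cross A B ((1 - d) • A + d • ((1 - b) • B + b • C)) =
      d * b * cross B C A := by
    simp [cross]; ring
  have e₂ : cross B C ((1 - d) • A + d • ((1 - b) • B + b • C)) =
      (1 - d) * cross B C A := by
    simp [cross]; ring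
  have e₃ : cross C A ((1 - d) • A + d • ((1 - b) • B + b • C)) =
      d * (1 - b) * cross B C A := by
    simp [cross]; ring
  rw [e₁, e₂, e₃, abs_mul (d * b), abs_mul (1 - d), abs_mul (d * (1 - b)),
    abs_of_nonneg (mul_nonneg hd' hb), abs_of_nonneg hc,
    abs_of_nonneg (mul_nonneg hd' ha)]
  ring
end

section
/- Let A, B, C be three non-collinear points in ℝ². If the distance sum function V is constant on the convex hull of {A, B, C} (i.e. there is a real number h with V(P) = h for all P in the convex hull), then the triangle is equilateral: dist A B = dist B C = dist C A. -/
/-- Twice the area of the triangle `P A B` is the distance from `P` to the line `A B` times the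
length of `A B`. -/
theorem lineDist_mul_dist (P A B : EuclideanSpace ℝ (Fin 2)) :
    lineDist P A B * dist A B
      = |(P 0 - A 0) * (B 1 - A 1) - (P 1 - A 1) * (B 0 - A 0)| := by
  rcases eq_or_ne A B with rfl | hAB
  · simp
  have hd : 0 < dist A B := dist_pos.mpr hAB
  have hsq (X Y : EuclideanSpace ℝ (Fin 2)) :
      dist X Y ^ 2 = (X 0 - Y 0) ^ 2 + (X 1 - Y 1) ^ 2 := by
    rw [EuclideanSpace.dist_sq_eq, Fin.sum_univ_two, Real.dist_eq, Real.dist_eq, sq_abs, sq_abs]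
  apply le_antisymm
  · have hD := hsq A B
    have hpos : 0 < dist A B ^ 2 := by positivity
    set t : ℝ := ((P 0 - A 0) * (B 0 - A 0) + (P 1 - A 1) * (B 1 - A 1)) / dist A B ^ 2
    have htm : t * dist A B ^ 2 = (P 0 - A 0) * (B 0 - A 0) + (P 1 - A 1) * (B 1 - A 1) :=
      div_mul_cancel₀ _ hpos.ne'
    have hle : lineDist P A B ≤ dist P (AffineMap.lineMap A B t) :=
      Metric.infDist_le_dist_of_mem (AffineMap.lineMap_mem_affineSpan_pair t A B)
    refine (mul_le_mul_of_nonneg_right hle hd.le).trans ?_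
    apply abs_le_of_sq_le_sq' _ (abs_nonneg _) |>.2
    rw [mul_pow, sq_abs, hsq P]
    simp only [AffineMap.lineMap_apply, vsub_eq_sub, vadd_eq_add, PiLp.add_apply, PiLp.smul_apply,
      PiLp.sub_apply, smul_eq_mul]
    rw [hD] at htm ⊢
    apply le_of_eq
    linear_combination (t * ((A 0 - B 0) ^ 2 + (A 1 - B 1) ^ 2)
      - ((P 0 - A 0) * (B 0 - A 0) + (P 1 - A 1) * (B 1 - A 1))) * htm
  · rw [← div_le_iff₀ hd]
    refine (Metric.le_infDist ⟨A, left_mem_affineSpan_pair ℝ A B⟩).mpr fun {y} hy => ?_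
    obtain ⟨t, rfl⟩ := mem_affineSpan_pair_iff_exists_lineMap_eq.mp hy
    rw [div_le_iff₀ hd]
    apply abs_le_of_sq_le_sq _ (by positivity)
    rw [mul_pow, hsq P, hsq A]
    simp only [AffineMap.lineMap_apply, vsub_eq_sub, vadd_eq_add, PiLp.add_apply, PiLp.smul_apply,
      PiLp.sub_apply, smul_eq_mul]
    nlinarith [sq_nonneg ((P 0 - (t * (B 0 - A 0) + A 0)) * (B 0 - A 0)
      + (P 1 - (t * (B 1 - A 1) + A 1)) * (B 1 - A 1))]

theorem lineDist_left (A B : EuclideanSpace ℝ (Fin 2)) : lineDist A A B = 0 :=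
  Metric.infDist_zero_of_mem (left_mem_affineSpan_pair ℝ A B)

theorem lineDist_right (A B : EuclideanSpace ℝ (Fin 2)) : lineDist B A B = 0 :=
  Metric.infDist_zero_of_mem (right_mem_affineSpan_pair ℝ A B)

theorem lineDist_ne_zero_of_not_collinear {A B C : EuclideanSpace ℝ (Fin 2)}
    (hncol : ¬ Collinear ℝ ({A, B, C} : Set (EuclideanSpace ℝ (Fin 2)))) :
    lineDist A B C ≠ 0 := fun h0 =>
  hncol <| collinear_insert_of_mem_affineSpan_pair <|
    ((AffineSubspace.closed_of_finiteDimensional _).mem_iff_infDist_zero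
      ⟨B, left_mem_affineSpan_pair ℝ B C⟩).mpr h0

/-- The product of a side and its altitude does not depend on the side. -/
theorem lineDist_mul_dist_rotate (A B C : EuclideanSpace ℝ (Fin 2)) :
    lineDist A B C * dist B C = lineDist B C A * dist C A := by
  rw [lineDist_mul_dist, lineDist_mul_dist]
  congr 1
  ring

theorem viviani_converse (A B C : EuclideanSpace ℝ (Fin 2))
    (hncol : ¬ Collinear ℝ ({A, B, C} : Set (EuclideanSpace ℝ (Fin 2))))
    (h : ℝ)
    (hconst : ∀ P ∈ convexHull ℝ ({A, B, C} : Set (EuclideanSpace ℝ (Fin 2))),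
      distSum A B C P = h) :
    dist A B = dist B C ∧ dist B C = dist C A := by
  have hA := hconst A (subset_convexHull ℝ _ (by simp))
  have hB := hconst B (subset_convexHull ℝ _ (by simp))
  have hC := hconst C (subset_convexHull ℝ _ (by simp))
  simp only [distSum, lineDist_left, lineDist_right, zero_add, add_zero] at hA hB hC
  have hne : h ≠ 0 := hA ▸ lineDist_ne_zero_of_not_collinear hncol
  have h₁ := lineDist_mul_dist_rotate A B C
  have h₂ := lineDist_mul_dist_rotate B C A
  rw [hA, hB] at h₁
  rw [hB, hC] at h₂
  exact ⟨mul_left_cancel₀ hne (h₁.trans h₂).symm, mul_left_cancel₀ hne h₁⟩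
end

section
/- Let A, B, C be three non-collinear points in ℝ². If there exist three non-collinear points P₁, P₂, P₃ in the convex hull of {A, B, C} with V(P₁) = V(P₂) = V(P₃), then V is constant on the convex hull of {A, B, C}: V(P) = V(P₁) for every P in the convex hull. -/
/-- On the triangle `A B C`, the distance to the line `A B` is an affine function. -/
theorem exists_affineMap_eq_lineDist (A B C : EuclideanSpace ℝ (Fin 2)) :
    ∃ f : EuclideanSpace ℝ (Fin 2) →ᵃ[ℝ] ℝ,
      ∀ P ∈ convexHull ℝ ({A, B, C} : Set (EuclideanSpace ℝ (Fin 2))), lineDist P A B = f P := by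
  let s : AffineSubspace ℝ (EuclideanSpace ℝ (Fin 2)) := affineSpan ℝ {A, B}
  have hA : A ∈ s := left_mem_affineSpan_pair ℝ A B
  have hB : B ∈ s := right_mem_affineSpan_pair ℝ A B
  have : Nonempty s := ⟨⟨A, hA⟩⟩
  let f : EuclideanSpace ℝ (Fin 2) →ᵃ[ℝ] ℝ := (s.signedInfDist C).toAffineMap
  have hf : ∀ x, f x = s.signedInfDist C x := fun _ => rfl
  refine ⟨f, fun P hP => ?_⟩
  have hnonneg : 0 ≤ f P := by
    have hsub : convexHull ℝ ({A, B, C} : Set (EuclideanSpace ℝ (Fin 2))) ⊆ f ⁻¹' Set.Ici 0 := by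
      refine convexHull_min ?_ ((convex_Ici 0).affine_preimage f)
      rintro x (rfl | rfl | rfl)
      · simp [hf, AffineSubspace.signedInfDist_apply_of_mem _ hA]
      · simp [hf, AffineSubspace.signedInfDist_apply_of_mem _ hB]
      · simp [hf]
    exact hsub hP
  have hmem : P ∈ affineSpan ℝ (insert C (s : Set (EuclideanSpace ℝ (Fin 2)))) := by
    refine affineSpan_mono ℝ ?_ (convexHull_subset_affineSpan _ hP)
    rintro x (rfl | rfl | rfl)
    · exact Or.inr hA
    · exact Or.inr hB
    · exact Or.inl rfl
  have habs := AffineSubspace.abs_signedInfDist_eq_dist_of_mem_affineSpan_insert hmem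
  rw [← hf, abs_of_nonneg hnonneg] at habs
  rw [lineDist, habs, EuclideanGeometry.dist_orthogonalProjection_eq_infDist]

theorem distSum_const_of_three_noncollinear_equal_values
    (A B C : EuclideanSpace ℝ (Fin 2))
    (hncol : ¬ Collinear ℝ ({A, B, C} : Set (EuclideanSpace ℝ (Fin 2))))
    (P₁ P₂ P₃ : EuclideanSpace ℝ (Fin 2))
    (hP₁ : P₁ ∈ convexHull ℝ ({A, B, C} : Set (EuclideanSpace ℝ (Fin 2))))
    (hP₂ : P₂ ∈ convexHull ℝ ({A, B, C} : Set (EuclideanSpace ℝ (Fin 2))))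
    (hP₃ : P₃ ∈ convexHull ℝ ({A, B, C} : Set (EuclideanSpace ℝ (Fin 2))))
    (hPncol : ¬ Collinear ℝ ({P₁, P₂, P₃} : Set (EuclideanSpace ℝ (Fin 2))))
    (h12 : distSum A B C P₁ = distSum A B C P₂)
    (h23 : distSum A B C P₂ = distSum A B C P₃) :
    ∀ P ∈ convexHull ℝ ({A, B, C} : Set (EuclideanSpace ℝ (Fin 2))),
      distSum A B C P = distSum A B C P₁ := by
  obtain ⟨f, hf⟩ := exists_affineMap_eq_lineDist A B C
  obtain ⟨g, hg⟩ := exists_affineMap_eq_lineDist B C A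
  obtain ⟨h, hh⟩ := exists_affineMap_eq_lineDist C A B
  have hBCA : ({B, C, A} : Set (EuclideanSpace ℝ (Fin 2))) = {A, B, C} := by
    ext; simp; tauto
  have hCAB : ({C, A, B} : Set (EuclideanSpace ℝ (Fin 2))) = {A, B, C} := by
    ext; simp; tauto
  rw [hBCA] at hg
  rw [hCAB] at hh
  have hV : ∀ P ∈ convexHull ℝ ({A, B, C} : Set (EuclideanSpace ℝ (Fin 2))),
      distSum A B C P = (f + g + h) P := fun P hP => by
    simp [distSum, hf P hP, hg P hP, hh P hP]
  have hspan : affineSpan ℝ (Set.range ![P₁, P₂, P₃]) = ⊤ := by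
    rw [AffineIndependent.affineSpan_eq_top_iff_card_eq_finrank_add_one
      (affineIndependent_iff_not_collinear_set.mpr hPncol)]
    simp
  have heq : f + g + h = AffineMap.const ℝ _ (distSum A B C P₁) := by
    refine AffineMap.ext_on hspan ?_
    rintro _ ⟨i, rfl⟩
    fin_cases i
    · exact (hV P₁ hP₁).symm
    · exact (hV P₂ hP₂).symm.trans h12.symm
    · exact (hV P₃ hP₃).symm.trans (h12.trans h23).symm
  intro P hP
  rw [hV P hP, heq, AffineMap.const_apply]
end

section
/- Let A, B, C be three non-collinear points in ℝ². Then there exists an affine map g : ℝ² → ℝ such that for every point P in the convex hull of {A, B, C}, V(P) = g(P). Consequently the triangle is divided into parallel line segments (the level sets of g restricted to the triangle) on which V is constant. -/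
theorem AffineSubspace.exists_affineMap_eq_infDist_on_convexHull_insert
    {V : Type*} [NormedAddCommGroup V] [InnerProductSpace ℝ V]
    (s : AffineSubspace ℝ V) [Nonempty s] [s.direction.HasOrthogonalProjection] (C : V) :
    ∃ g : V →ᵃ[ℝ] ℝ, ∀ P ∈ convexHull ℝ (insert C (s : Set V)),
      Metric.infDist P (s : Set V) = g P := by
  let f : V →ᵃ[ℝ] V := AffineMap.id ℝ V -
    s.subtype.comp (EuclideanGeometry.orthogonalProjection s).toAffineMap
  have hf (P : V) : f P = P - EuclideanGeometry.orthogonalProjection s P := rfl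
  refine ⟨((‖f C‖⁻¹ • innerₛₗ ℝ (f C)).toAffineMap).comp f, fun P hP ↦ ?_⟩
  rw [convexHull_insert (Set.nonempty_coe_sort.mp ‹Nonempty s›),
    s.convex.convexHull_eq] at hP
  obtain ⟨M, hM, hP⟩ := by simpa using hP
  rw [segment_eq_image_lineMap] at hP
  obtain ⟨t, ⟨-, ht⟩, rfl⟩ := hP
  have hfM : f M = 0 := by
    rw [hf, EuclideanGeometry.orthogonalProjection_eq_self_iff.mpr hM, sub_self]
  have hfP : f (AffineMap.lineMap C M t) = (1 - t) • f C := by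
    rw [AffineMap.apply_lineMap, hfM, AffineMap.lineMap_apply_module, smul_zero, add_zero]
  rw [← EuclideanGeometry.dist_orthogonalProjection_eq_infDist, dist_eq_norm, ← hf,
    AffineMap.comp_apply, hfP, norm_smul, Real.norm_of_nonneg (sub_nonneg.mpr ht)]
  by_cases h : f C = 0
  · simp [h]
  · have := norm_ne_zero_iff.mpr h
    rw [LinearMap.coe_toAffineMap, LinearMap.smul_apply, innerₛₗ_apply_apply, inner_smul_right,
      real_inner_self_eq_norm_sq, smul_eq_mul]
    field_simp

theorem exists_affineMap_eq_lineDist_on_triangle (A B C : EuclideanSpace ℝ (Fin 2)) :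
    ∃ g : EuclideanSpace ℝ (Fin 2) →ᵃ[ℝ] ℝ,
      ∀ P ∈ convexHull ℝ ({A, B, C} : Set (EuclideanSpace ℝ (Fin 2))), lineDist P A B = g P := by
  obtain ⟨g, hg⟩ := AffineSubspace.exists_affineMap_eq_infDist_on_convexHull_insert
    (affineSpan ℝ {A, B}) C
  refine ⟨g, fun P hP ↦ hg P (convexHull_mono ?_ hP)⟩
  rintro x (rfl | rfl | rfl)
  · exact Or.inr (left_mem_affineSpan_pair ℝ _ _)
  · exact Or.inr (right_mem_affineSpan_pair ℝ _ _)
  · exact Or.inl rfl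

theorem distSum_affine_on_triangle
    (A B C : EuclideanSpace ℝ (Fin 2))
    (hncol : ¬ Collinear ℝ ({A, B, C} : Set (EuclideanSpace ℝ (Fin 2)))) :
    ∃ g : EuclideanSpace ℝ (Fin 2) →ᵃ[ℝ] ℝ,
      ∀ P ∈ convexHull ℝ ({A, B, C} : Set (EuclideanSpace ℝ (Fin 2))),
        distSum A B C P = g P := by
  obtain ⟨g₁, h₁⟩ := exists_affineMap_eq_lineDist_on_triangle A B C
  obtain ⟨g₂, h₂⟩ := exists_affineMap_eq_lineDist_on_triangle B C A
  obtain ⟨g₃, h₃⟩ := exists_affineMap_eq_lineDist_on_triangle C A B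
  have hBCA : ({B, C, A} : Set (EuclideanSpace ℝ (Fin 2))) = {A, B, C} := by
    ext; simp; tauto
  have hCAB : ({C, A, B} : Set (EuclideanSpace ℝ (Fin 2))) = {A, B, C} := by
    ext; simp; tauto
  rw [hBCA] at h₂
  rw [hCAB] at h₃
  refine ⟨g₁ + g₂ + g₃, fun P hP ↦ ?_⟩
  simp [distSum, h₁ P hP, h₂ P hP, h₃ P hP]
end

section
/- Let n ≥ 1, let n₁, …, nₙ be unit vectors in ℝ² and c₁, …, cₙ real numbers, and let K = {x ∈ ℝ² : ⟪x, nᵢ⟫ ≤ cᵢ for all i} be the corresponding convex polygon; assume K has nonempty interior. For each i let ℓᵢ = {x ∈ ℝ² : ⟪x, nᵢ⟫ = cᵢ} be the i-th side-line. Then there exists an affine map g : ℝ² → ℝ such that for every P ∈ K, the distance sum Σᵢ dist(P, ℓᵢ) equals g(P). Consequently K is divided into parallel line segments on which the distance sum is constant. -/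
open scoped RealInnerProductSpace

theorem infDist_hyperplane_eq_sub_inner {E : Type*} [NormedAddCommGroup E]
    [InnerProductSpace ℝ E] {v x : E} {a : ℝ} (hv : ‖v‖ = 1) (hx : ⟪x, v⟫ ≤ a) :
    Metric.infDist x {y : E | ⟪y, v⟫ = a} = a - ⟪x, v⟫ := by
  have hmem : x + (a - ⟪x, v⟫) • v ∈ {y : E | ⟪y, v⟫ = a} := by
    simp [inner_add_left, real_inner_smul_left, hv]
  apply le_antisymm
  · refine (Metric.infDist_le_dist_of_mem hmem).trans_eq ?_
    rw [dist_self_add_right, norm_smul, hv, mul_one, Real.norm_of_nonneg (sub_nonneg.2 hx)]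
  · refine (Metric.le_infDist ⟨_, hmem⟩).2 fun y (hy : ⟪y, v⟫ = a) => ?_
    calc a - ⟪x, v⟫ = ⟪y - x, v⟫ := by rw [inner_sub_left, hy]
      _ ≤ ‖y - x‖ * ‖v‖ := real_inner_le_norm _ _
      _ = dist x y := by rw [hv, mul_one, dist_comm, dist_eq_norm]

theorem distSum_affine_on_convex_polygon
    (n : ℕ) (hn : 1 ≤ n)
    (nv : Fin n → EuclideanSpace ℝ (Fin 2)) (c : Fin n → ℝ)
    (hunit : ∀ i, ‖nv i‖ = 1)
    (K : Set (EuclideanSpace ℝ (Fin 2)))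
    (hK : K = {x : EuclideanSpace ℝ (Fin 2) | ∀ i, ⟪x, nv i⟫ ≤ c i})
    (hint : (interior K).Nonempty)
    (ℓ : Fin n → Set (EuclideanSpace ℝ (Fin 2)))
    (hℓ : ∀ i, ℓ i = {x : EuclideanSpace ℝ (Fin 2) | ⟪x, nv i⟫ = c i}) :
    ∃ g : EuclideanSpace ℝ (Fin 2) →ᵃ[ℝ] ℝ,
      ∀ P ∈ K, ∑ i, Metric.infDist P (ℓ i) = g P := by
  subst hK
  refine ⟨AffineMap.const ℝ _ (∑ i, c i) - (innerSL ℝ (∑ i, nv i)).toLinearMap.toAffineMap,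
    fun P hP => ?_⟩
  have hdist (i) : Metric.infDist P (ℓ i) = c i - ⟪P, nv i⟫ := by
    rw [hℓ i, infDist_hyperplane_eq_sub_inner (hunit i) (hP i)]
  simp [hdist, Finset.sum_sub_distrib, real_inner_comm P]
end

section
/- Let n ≥ 1, let n₁, …, nₙ be unit vectors in ℝ² and c₁, …, cₙ real numbers, let K = {x ∈ ℝ² : ⟪x, nᵢ⟫ ≤ cᵢ for all i} have nonempty interior, and let ℓᵢ = {x : ⟪x, nᵢ⟫ = cᵢ}. If there exist three non-collinear points P₁, P₂, P₃ ∈ K at which the distance sum Σᵢ dist(·, ℓᵢ) takes the same value, then the distance sum is constant on K. -/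
open scoped RealInnerProductSpace

/-- The distance from a point to the hyperplane `⟪y, v⟫ = c` with unit normal `v`. -/
theorem infDist_hyperplane_of_norm_eq_one {E : Type*} [NormedAddCommGroup E]
    [InnerProductSpace ℝ E] {v : E} (hv : ‖v‖ = 1) (c : ℝ) (x : E) :
    Metric.infDist x {y : E | ⟪y, v⟫ = c} = |⟪x, v⟫ - c| := by
  have hmem : x - (⟪x, v⟫ - c) • v ∈ {y : E | ⟪y, v⟫ = c} := by
    simp [inner_sub_left, real_inner_smul_left, hv]
  apply le_antisymm
  · refine (Metric.infDist_le_dist_of_mem hmem).trans_eq ?_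
    simp [norm_smul, hv]
  · refine (Metric.le_infDist ⟨_, hmem⟩).2 fun y hy => ?_
    calc |⟪x, v⟫ - c| = |⟪x - y, v⟫| := by rw [inner_sub_left, show ⟪y, v⟫ = c from hy]
      _ ≤ ‖x - y‖ * ‖v‖ := abs_real_inner_le_norm _ _
      _ = dist x y := by rw [hv, mul_one, dist_eq_norm]

/-- In the plane, a vector whose inner products with three non-collinear points agree is zero. -/
theorem eq_zero_of_inner_eq_of_not_collinear {P₁ P₂ P₃ v : EuclideanSpace ℝ (Fin 2)}
    (hP : ¬ Collinear ℝ ({P₁, P₂, P₃} : Set (EuclideanSpace ℝ (Fin 2))))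
    (h12 : ⟪P₁, v⟫ = ⟪P₂, v⟫) (h23 : ⟪P₂, v⟫ = ⟪P₃, v⟫) : v = 0 := by
  have hspan : vectorSpan ℝ (Set.range ![P₁, P₂, P₃]) = ⊤ :=
    (affineIndependent_iff_not_collinear_set.2 hP).vectorSpan_eq_top_of_card_eq_finrank_add_one
      (by simp)
  have hle : vectorSpan ℝ (Set.range ![P₁, P₂, P₃]) ≤ (ℝ ∙ v)ᗮ := by
    rw [vectorSpan_def, Submodule.span_le]
    rintro _ ⟨_, ⟨i, rfl⟩, _, ⟨j, rfl⟩, rfl⟩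
    rw [SetLike.mem_coe, Submodule.mem_orthogonal_singleton_iff_inner_left]
    fin_cases i <;> fin_cases j <;> simp [inner_sub_left, h12, h23]
  rw [hspan, top_le_iff, Submodule.orthogonal_eq_top_iff, Submodule.span_singleton_eq_bot] at hle
  exact hle

theorem distSum_const_on_convex_polygon_of_three_noncollinear
    (n : ℕ) (hn : 1 ≤ n)
    (nv : Fin n → EuclideanSpace ℝ (Fin 2)) (c : Fin n → ℝ)
    (hunit : ∀ i, ‖nv i‖ = 1)
    (K : Set (EuclideanSpace ℝ (Fin 2)))
    (hK : K = {x : EuclideanSpace ℝ (Fin 2) | ∀ i, ⟪x, nv i⟫ ≤ c i})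
    (hint : (interior K).Nonempty)
    (ℓ : Fin n → Set (EuclideanSpace ℝ (Fin 2)))
    (hℓ : ∀ i, ℓ i = {x : EuclideanSpace ℝ (Fin 2) | ⟪x, nv i⟫ = c i})
    (P₁ P₂ P₃ : EuclideanSpace ℝ (Fin 2))
    (hP₁ : P₁ ∈ K) (hP₂ : P₂ ∈ K) (hP₃ : P₃ ∈ K)
    (hPncol : ¬ Collinear ℝ ({P₁, P₂, P₃} : Set (EuclideanSpace ℝ (Fin 2))))
    (h12 : ∑ i, Metric.infDist P₁ (ℓ i) = ∑ i, Metric.infDist P₂ (ℓ i))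
    (h23 : ∑ i, Metric.infDist P₂ (ℓ i) = ∑ i, Metric.infDist P₃ (ℓ i)) :
    ∀ P ∈ K, ∀ Q ∈ K,
      ∑ i, Metric.infDist P (ℓ i) = ∑ i, Metric.infDist Q (ℓ i) := by
  have hdist : ∀ P ∈ K, ∑ i, Metric.infDist P (ℓ i) = ∑ i, c i - ⟪P, ∑ i, nv i⟫ := by
    intro P hP
    rw [hK] at hP
    rw [inner_sum, ← Finset.sum_sub_distrib]
    refine Finset.sum_congr rfl fun i _ => ?_
    rw [hℓ, infDist_hyperplane_of_norm_eq_one (hunit i), abs_sub_comm,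
      abs_of_nonneg (sub_nonneg.2 (hP i))]
  rw [hdist P₁ hP₁, hdist P₂ hP₂, sub_right_inj] at h12
  rw [hdist P₂ hP₂, hdist P₃ hP₃, sub_right_inj] at h23
  have hsum := eq_zero_of_inner_eq_of_not_collinear hPncol h12 h23
  intro P hP Q hQ
  rw [hdist P hP, hdist Q hQ, hsum, inner_zero_right, inner_zero_right]
end

section
/- Let A, B, C be three non-collinear points in ℝ², and let h_A = dist(A, line BC), h_B = dist(B, line CA), h_C = dist(C, line AB) be the three altitudes of the triangle. Then the range of the distance sum function V on the convex hull of {A, B, C} is exactly the closed interval [min(h_A, h_B, h_C), max(h_A, h_B, h_C)]: every P in the convex hull satisfies min(h_A,h_B,h_C) ≤ V(P) ≤ max(h_A,h_B,h_C), and for every t in this interval there exists P in the convex hull with V(P) = t. -/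
theorem AffineSubspace.infDist_smul_vsub_vadd {V P : Type*} [NormedAddCommGroup V]
    [InnerProductSpace ℝ V] [MetricSpace P] [NormedAddTorsor V P] (s : AffineSubspace ℝ P)
    [s.direction.HasOrthogonalProjection] {q p₀ : P} (hq : q ∈ s) (hp₀ : p₀ ∈ s) (r : ℝ) (p : P) :
    Metric.infDist (r • (p -ᵥ q) +ᵥ p₀) (s : Set P) = |r| * Metric.infDist p (s : Set P) := by
  have : Nonempty s := ⟨⟨q, hq⟩⟩
  set y := (EuclideanGeometry.orthogonalProjection s p : P) with hy
  have hys : y ∈ s := EuclideanGeometry.orthogonalProjection_mem p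
  have hv : p -ᵥ y ∈ s.directionᗮ :=
    EuclideanGeometry.vsub_orthogonalProjection_mem_direction_orthogonal s p
  have hz : r • (y -ᵥ q) +ᵥ p₀ ∈ s :=
    AffineSubspace.vadd_mem_of_mem_direction
      (s.direction.smul_mem r (AffineSubspace.vsub_mem_direction hys hq)) hp₀
  have hsplit : r • (p -ᵥ q) +ᵥ p₀ = r • (p -ᵥ y) +ᵥ (r • (y -ᵥ q) +ᵥ p₀) := by
    rw [vadd_vadd, ← smul_add, vsub_add_vsub_cancel]
  rw [← EuclideanGeometry.dist_orthogonalProjection_eq_infDist,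
    ← EuclideanGeometry.dist_orthogonalProjection_eq_infDist, hsplit,
    EuclideanGeometry.orthogonalProjection_vadd_eq_self hz (s.directionᗮ.smul_mem r hv), ← hy,
    dist_eq_norm_vsub V, vadd_vsub, norm_smul, Real.norm_eq_abs,
    dist_eq_norm_vsub V p y]

theorem lineDist_barycentric (A B C : EuclideanSpace ℝ (Fin 2)) {a b c : ℝ} (ha : 0 ≤ a)
    (h : a + b + c = 1) :
    lineDist (a • A + b • B + c • C) B C = a * lineDist A B C := by
  have key := (affineSpan ℝ {B, C}).infDist_smul_vsub_vadd (left_mem_affineSpan_pair ℝ B C)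
    (AffineMap.lineMap_mem_affineSpan_pair c B C) a A
  rw [abs_of_nonneg ha] at key
  unfold lineDist
  rw [← key]
  congr 1
  obtain rfl : b = 1 - a - c := by linarith
  simp only [AffineMap.lineMap_apply, vsub_eq_sub, vadd_eq_add]
  module

theorem distSum_barycentric (A B C : EuclideanSpace ℝ (Fin 2)) {a b c : ℝ} (ha : 0 ≤ a)
    (hb : 0 ≤ b) (hc : 0 ≤ c) (h : a + b + c = 1) :
    distSum A B C (a • A + b • B + c • C) =
      a * lineDist A B C + b * lineDist B C A + c * lineDist C A B := by
  have hA := lineDist_barycentric A B C ha h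
  have hB := lineDist_barycentric B C A (a := b) (b := c) (c := a) hb (by linarith)
  have hC := lineDist_barycentric C A B (a := c) (b := a) (c := b) hc (by linarith)
  rw [show b • B + c • C + a • A = a • A + b • B + c • C by abel] at hB
  rw [show c • C + a • A + b • B = a • A + b • B + c • C by abel] at hC
  rw [distSum, hA, hB, hC]
  ring

theorem continuous_distSum (A B C : EuclideanSpace ℝ (Fin 2)) : Continuous (distSum A B C) :=
  ((Metric.continuous_infDist_pt _).add (Metric.continuous_infDist_pt _)).add
    (Metric.continuous_infDist_pt _)

theorem mem_convexHull_triple {E : Type*} [AddCommGroup E] [Module ℝ E] {A B C P : E}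
    (hP : P ∈ convexHull ℝ ({A, B, C} : Set E)) :
    ∃ a b c : ℝ, 0 ≤ a ∧ 0 ≤ b ∧ 0 ≤ c ∧ a + b + c = 1 ∧ P = a • A + b • B + c • C := by
  rw [convexHull_insert (Set.insert_nonempty _ _), convexHull_pair, mem_convexJoin] at hP
  obtain ⟨_, rfl, Q, ⟨u, v, hu, hv, huv, rfl⟩, x, y, hx, hy, hxy, rfl⟩ := hP
  refine ⟨x, y * u, y * v, hx, mul_nonneg hy hu, mul_nonneg hy hv, ?_, by module⟩
  rw [add_assoc, ← mul_add, huv, mul_one, hxy]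

theorem distSum_range_eq_Icc_min_max_altitude
    (A B C : EuclideanSpace ℝ (Fin 2))
    (hncol : ¬ Collinear ℝ ({A, B, C} : Set (EuclideanSpace ℝ (Fin 2)))) :
    (∀ P ∈ convexHull ℝ ({A, B, C} : Set (EuclideanSpace ℝ (Fin 2))),
        min (lineDist A B C) (min (lineDist B C A) (lineDist C A B)) ≤ distSum A B C P ∧
        distSum A B C P ≤ max (lineDist A B C) (max (lineDist B C A) (lineDist C A B))) ∧
    (∀ t : ℝ,
      min (lineDist A B C) (min (lineDist B C A) (lineDist C A B)) ≤ t →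
      t ≤ max (lineDist A B C) (max (lineDist B C A) (lineDist C A B)) →
      ∃ P ∈ convexHull ℝ ({A, B, C} : Set (EuclideanSpace ℝ (Fin 2))),
        distSum A B C P = t) := by
  have hVA : distSum A B C A = lineDist A B C := by
    simp [distSum, lineDist_left, lineDist_right]
  have hVB : distSum A B C B = lineDist B C A := by
    simp [distSum, lineDist_left, lineDist_right]
  have hVC : distSum A B C C = lineDist C A B := by
    simp [distSum, lineDist_left, lineDist_right]
  have hA : A ∈ convexHull ℝ ({A, B, C} : Set (EuclideanSpace ℝ (Fin 2))) :=
    subset_convexHull ℝ _ (by simp)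
  have hB : B ∈ convexHull ℝ ({A, B, C} : Set (EuclideanSpace ℝ (Fin 2))) :=
    subset_convexHull ℝ _ (by simp)
  have hC : C ∈ convexHull ℝ ({A, B, C} : Set (EuclideanSpace ℝ (Fin 2))) :=
    subset_convexHull ℝ _ (by simp)
  constructor
  · intro P hP
    obtain ⟨a, b, c, ha, hb, hc, h, rfl⟩ := mem_convexHull_triple hP
    rw [distSum_barycentric A B C ha hb hc h]
    set m := min (lineDist A B C) (min (lineDist B C A) (lineDist C A B)) with hm
    set M := max (lineDist A B C) (max (lineDist B C A) (lineDist C A B)) with hM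
    constructor
    · calc m = a * m + b * m + c * m := by rw [← add_mul, ← add_mul, h, one_mul]
        _ ≤ _ := by gcongr <;> simp [hm]
    · calc _ ≤ a * M + b * M + c * M := by gcongr <;> simp [hM]
        _ = M := by rw [← add_mul, ← add_mul, h, one_mul]
  · intro t hmin hmax
    obtain ⟨X, hX, hXt⟩ : ∃ X ∈ convexHull ℝ ({A, B, C} : Set (EuclideanSpace ℝ (Fin 2))),
        distSum A B C X ≤ t := by
      rcases min_le_iff.1 hmin with h | h
      · exact ⟨A, hA, hVA.trans_le h⟩
      rcases min_le_iff.1 h with h | h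
      · exact ⟨B, hB, hVB.trans_le h⟩
      · exact ⟨C, hC, hVC.trans_le h⟩
    obtain ⟨Y, hY, hYt⟩ : ∃ Y ∈ convexHull ℝ ({A, B, C} : Set (EuclideanSpace ℝ (Fin 2))),
        t ≤ distSum A B C Y := by
      rcases le_max_iff.1 hmax with h | h
      · exact ⟨A, hA, h.trans_eq hVA.symm⟩
      rcases le_max_iff.1 h with h | h
      · exact ⟨B, hB, h.trans_eq hVB.symm⟩
      · exact ⟨C, hC, h.trans_eq hVC.symm⟩
    exact (convex_convexHull ℝ _).isPreconnected.intermediate_value hX hY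
      (continuous_distSum A B C).continuousOn ⟨hXt, hYt⟩
end

section
/- Let A, B, C be three non-collinear points in ℝ², let S(P) = dist(P, line AB)² + dist(P, line BC)² + dist(P, line CA)², and let m = infimum of S over ℝ² (which is attained). Then for every real number k > m, the level set {P ∈ ℝ² : S(P) = k} is an ellipse: there exists an invertible affine map φ : ℝ² → ℝ² such that {P : S(P) = k} = φ '' (unit circle {x ∈ ℝ² : ‖x‖ = 1}). -/
noncomputable def sqDistSum (A B C P : EuclideanSpace ℝ (Fin 2)) : ℝ :=
  lineDist P A B ^ 2 + lineDist P B C ^ 2 + lineDist P C A ^ 2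

/-- The coordinate form of the area of the parallelogram spanned by `B - A` and `P - A`. -/
noncomputable def planeCross (A B P : EuclideanSpace ℝ (Fin 2)) : ℝ :=
  (B 0 - A 0) * (P 1 - A 1) - (B 1 - A 1) * (P 0 - A 0)

theorem collinear_of_planeCross_eq_zero {A B C : EuclideanSpace ℝ (Fin 2)}
    (h : planeCross A B C = 0) : Collinear ℝ ({A, B, C} : Set (EuclideanSpace ℝ (Fin 2))) := by
  unfold planeCross at h
  by_cases hAB : A = B
  · subst hAB
    simpa using collinear_pair ℝ A C
  rw [collinear_iff_of_mem (p₀ := A) (by simp)]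
  refine ⟨B - A, ?_⟩
  simp only [Set.mem_insert_iff, Set.mem_singleton_iff, forall_eq_or_imp, forall_eq, vadd_eq_add]
  refine ⟨⟨0, by simp⟩, ⟨1, by simp⟩, ?_⟩
  by_cases h0 : B 0 - A 0 = 0
  · have h1 : B 1 - A 1 ≠ 0 := fun h1 => hAB <| by
      ext i
      fin_cases i <;> simp <;> linarith
    refine ⟨(C 1 - A 1) / (B 1 - A 1), ?_⟩
    ext i
    fin_cases i <;> simp <;> field_simp <;> linarith
  · refine ⟨(C 0 - A 0) / (B 0 - A 0), ?_⟩
    ext i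
    fin_cases i <;> simp <;> field_simp <;> linarith

theorem sq_add_sq_pos_of_ne {A B : EuclideanSpace ℝ (Fin 2)} (hAB : A ≠ B) :
    0 < (B 0 - A 0) ^ 2 + (B 1 - A 1) ^ 2 := by
  by_contra! h
  refine hAB ?_
  ext i
  fin_cases i <;> simp <;> nlinarith [sq_nonneg (B 0 - A 0), sq_nonneg (B 1 - A 1)]

theorem lineDist_sq {A B : EuclideanSpace ℝ (Fin 2)} (hAB : A ≠ B)
    (P : EuclideanSpace ℝ (Fin 2)) :
    lineDist P A B ^ 2 = planeCross A B P ^ 2 / ((B 0 - A 0) ^ 2 + (B 1 - A 1) ^ 2) := by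
  have hn := sq_add_sq_pos_of_ne hAB
  set n := (B 0 - A 0) ^ 2 + (B 1 - A 1) ^ 2 with hn_def
  set t := ((P 0 - A 0) * (B 0 - A 0) + (P 1 - A 1) * (B 1 - A 1)) / n with ht
  have hdist (s : ℝ) :
      dist P (AffineMap.lineMap A B s) = √(planeCross A B P ^ 2 / n + n * (s - t) ^ 2) := by
    rw [EuclideanSpace.dist_eq, Fin.sum_univ_two]
    congr 1
    simp only [AffineMap.lineMap_apply, Real.dist_eq, sq_abs, vsub_eq_sub, vadd_eq_add,
      PiLp.add_apply, PiLp.smul_apply, PiLp.sub_apply, smul_eq_mul, planeCross, ht]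
    field_simp
    rw [hn_def]
    ring
  have h : lineDist P A B = √(planeCross A B P ^ 2 / n) := by
    refine le_antisymm ?_ ?_
    · have := Metric.infDist_le_dist_of_mem (x := P)
        (AffineMap.lineMap_mem_affineSpan_pair (k := ℝ) t A B)
      simpa [lineDist, hdist] using this
    · refine (Metric.le_infDist ⟨A, left_mem_affineSpan_pair ℝ A B⟩).2 fun {y} hy => ?_
      obtain ⟨s, rfl⟩ := mem_affineSpan_pair_iff_exists_lineMap_eq.1 hy
      rw [hdist]
      exact Real.sqrt_le_sqrt (le_add_of_nonneg_right (by positivity))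
  rw [h, Real.sq_sqrt (by positivity)]

/-- The triangular linear automorphism `(x, y) ↦ (p x + q y, s y)` of the plane. -/
noncomputable def triangularEquiv (p q s : ℝ) (hp : p ≠ 0) (hs : s ≠ 0) :
    EuclideanSpace ℝ (Fin 2) ≃ₗ[ℝ] EuclideanSpace ℝ (Fin 2) where
  toFun P := !₂[p * P 0 + q * P 1, s * P 1]
  invFun Q := !₂[(Q 0 - q * (Q 1 / s)) / p, Q 1 / s]
  map_add' P Q := by
    ext i
    fin_cases i <;> simp <;> ring
  map_smul' r P := by
    ext i
    fin_cases i <;> simp <;> ring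
  left_inv P := by
    ext i
    fin_cases i <;> simp <;> field_simp
    ring
  right_inv Q := by
    ext i
    fin_cases i <;> simp <;> field_simp
    ring

theorem exists_affineEquiv_quadratic_eq (a b c d e f : ℝ) (ha : 0 < a)
    (hD : 0 < a * c - b ^ 2) :
    ∃ (ψ : EuclideanSpace ℝ (Fin 2) ≃ᵃ[ℝ] EuclideanSpace ℝ (Fin 2)) (μ : ℝ), ∀ P,
      a * P 0 ^ 2 + 2 * b * (P 0 * P 1) + c * P 1 ^ 2 + 2 * d * P 0 + 2 * e * P 1 + f =
        μ + ‖ψ P‖ ^ 2 := by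
  obtain ⟨p, hp, hpa⟩ : ∃ p : ℝ, 0 < p ∧ p ^ 2 = a := ⟨√a, by positivity, Real.sq_sqrt ha.le⟩
  obtain ⟨s, hs, hsD⟩ : ∃ s : ℝ, 0 < s ∧ s ^ 2 = (a * c - b ^ 2) / a :=
    ⟨√((a * c - b ^ 2) / a), by positivity, Real.sq_sqrt (by positivity)⟩
  obtain ⟨q, hq⟩ : ∃ q, p * q = b := ⟨b / p, by field_simp⟩
  obtain ⟨g, hg⟩ : ∃ g, p * g = d := ⟨d / p, by field_simp⟩
  obtain ⟨h, hh⟩ : ∃ h, s * h = e - q * g := ⟨(e - q * g) / s, by field_simp⟩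
  have hc : c = q ^ 2 + s ^ 2 := by
    rw [hsD, ← hq, ← hpa]
    field_simp
    ring
  have he : e = s * h + q * g := by linarith
  refine ⟨(triangularEquiv p q s hp.ne' hs.ne').toAffineEquiv.trans
    (AffineEquiv.constVAdd ℝ _ !₂[g, h]), f - g ^ 2 - h ^ 2, fun P => ?_⟩
  rw [EuclideanSpace.norm_sq_eq, Fin.sum_univ_two]
  simp only [AffineEquiv.trans_apply, LinearEquiv.coe_toAffineEquiv, triangularEquiv,
    AffineEquiv.constVAdd_apply, vadd_eq_add, PiLp.add_apply, Real.norm_eq_abs, sq_abs]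
  simp only [LinearEquiv.coe_mk, LinearMap.coe_mk, AddHom.coe_mk, PiLp.toLp_apply,
    Matrix.cons_val_zero, Matrix.cons_val_one, Matrix.cons_val_fin_one]
  rw [he, hc, ← hg, ← hq, ← hpa]
  ring

theorem exists_affineEquiv_sqDistSum_eq {A B C : EuclideanSpace ℝ (Fin 2)}
    (hncol : ¬ Collinear ℝ ({A, B, C} : Set (EuclideanSpace ℝ (Fin 2)))) :
    ∃ (ψ : EuclideanSpace ℝ (Fin 2) ≃ᵃ[ℝ] EuclideanSpace ℝ (Fin 2)) (μ : ℝ), ∀ P,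
      sqDistSum A B C P = μ + ‖ψ P‖ ^ 2 := by
  have hcross : planeCross A B C ≠ 0 := mt collinear_of_planeCross_eq_zero hncol
  have hAB : A ≠ B := by rintro rfl; simp [planeCross] at hcross
  have hBC : B ≠ C := by rintro rfl; exact hcross (by unfold planeCross; ring)
  have hCA : C ≠ A := by rintro rfl; simp [planeCross] at hcross
  have h₁ := inv_pos.2 (sq_add_sq_pos_of_ne hAB)
  have h₂ := inv_pos.2 (sq_add_sq_pos_of_ne hBC)
  have h₃ := inv_pos.2 (sq_add_sq_pos_of_ne hCA)
  simp only [sqDistSum, lineDist_sq hAB, lineDist_sq hBC, lineDist_sq hCA, div_eq_mul_inv]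
  generalize ((B 0 - A 0) ^ 2 + (B 1 - A 1) ^ 2)⁻¹ = u at *
  generalize ((C 0 - B 0) ^ 2 + (C 1 - B 1) ^ 2)⁻¹ = v at *
  generalize ((A 0 - C 0) ^ 2 + (A 1 - C 1) ^ 2)⁻¹ = w at *
  set t₁ := (B 1 - A 1) * A 0 - (B 0 - A 0) * A 1 with ht₁
  set t₂ := (C 1 - B 1) * B 0 - (C 0 - B 0) * B 1 with ht₂
  set t₃ := (A 1 - C 1) * C 0 - (A 0 - C 0) * C 1 with ht₃
  set a := u * (B 1 - A 1) ^ 2 + v * (C 1 - B 1) ^ 2 + w * (A 1 - C 1) ^ 2 with ha_def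
  set b := -(u * ((B 0 - A 0) * (B 1 - A 1)) + v * ((C 0 - B 0) * (C 1 - B 1)) +
    w * ((A 0 - C 0) * (A 1 - C 1))) with hb
  set c := u * (B 0 - A 0) ^ 2 + v * (C 0 - B 0) ^ 2 + w * (A 0 - C 0) ^ 2 with hc
  have hD : a * c - b ^ 2 = (u * v + v * w + w * u) * planeCross A B C ^ 2 := by
    rw [ha_def, hb, hc, planeCross]
    ring
  have hD_pos : 0 < a * c - b ^ 2 := by
    rw [hD]
    positivity
  have ha : 0 < a := by
    have ha₀ : 0 ≤ a := by positivity
    refine ha₀.lt_of_ne fun h => ?_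
    rw [← h] at hD_pos
    nlinarith [sq_nonneg b]
  obtain ⟨ψ, μ, hψ⟩ := exists_affineEquiv_quadratic_eq a b c
    (-(u * ((B 1 - A 1) * t₁) + v * ((C 1 - B 1) * t₂) + w * ((A 1 - C 1) * t₃)))
    (u * ((B 0 - A 0) * t₁) + v * ((C 0 - B 0) * t₂) + w * ((A 0 - C 0) * t₃))
    (u * t₁ ^ 2 + v * t₂ ^ 2 + w * t₃ ^ 2) ha hD_pos
  refine ⟨ψ, μ, fun P => ?_⟩
  rw [← hψ, ha_def, hb, hc, ht₁, ht₂, ht₃]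
  unfold planeCross
  ring

theorem sqDistSum_level_set_is_ellipse
    (A B C : EuclideanSpace ℝ (Fin 2))
    (hncol : ¬ Collinear ℝ ({A, B, C} : Set (EuclideanSpace ℝ (Fin 2))))
    (m : ℝ) (hm : IsGLB (Set.range (sqDistSum A B C)) m) :
    (∃ P, sqDistSum A B C P = m) ∧
    ∀ k : ℝ, m < k →
      ∃ φ : EuclideanSpace ℝ (Fin 2) ≃ᵃ[ℝ] EuclideanSpace ℝ (Fin 2),
        {P : EuclideanSpace ℝ (Fin 2) | sqDistSum A B C P = k} =
          ⇑φ '' {x : EuclideanSpace ℝ (Fin 2) | ‖x‖ = 1} := by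
  obtain ⟨ψ, μ, hψ⟩ := exists_affineEquiv_sqDistSum_eq hncol
  have hμ : sqDistSum A B C (ψ.symm 0) = μ := by simp [hψ]
  have hleast : IsLeast (Set.range (sqDistSum A B C)) μ := by
    refine ⟨⟨_, hμ⟩, ?_⟩
    rintro _ ⟨P, rfl⟩
    rw [hψ]
    exact le_add_of_nonneg_right (sq_nonneg _)
  obtain rfl : m = μ := hm.unique hleast.isGLB
  refine ⟨⟨_, hμ⟩, fun k hk => ?_⟩
  obtain ⟨r, hr, hrk⟩ : ∃ r : ℝ, 0 < r ∧ r ^ 2 = k - m :=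
    ⟨√(k - m), Real.sqrt_pos.2 (sub_pos.2 hk), Real.sq_sqrt (sub_pos.2 hk).le⟩
  refine ⟨(LinearEquiv.smulOfNeZero ℝ (EuclideanSpace ℝ (Fin 2)) r hr.ne').toAffineEquiv.trans
    ψ.symm, ?_⟩
  ext P
  simp only [Set.mem_ofPred_eq, Set.mem_image, hψ, AffineEquiv.trans_apply,
    LinearEquiv.coe_toAffineEquiv, LinearEquiv.smulOfNeZero_apply]
  constructor
  · intro h
    have hnorm : ‖ψ P‖ = r := by
      rw [← sq_eq_sq₀ (norm_nonneg _) hr.le]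
      linarith
    refine ⟨r⁻¹ • ψ P, ?_, ?_⟩
    · rw [norm_smul, hnorm, Real.norm_of_nonneg (by positivity), inv_mul_cancel₀ hr.ne']
    · rw [smul_inv_smul₀ hr.ne', AffineEquiv.symm_apply_apply]
  · rintro ⟨x, hx, rfl⟩
    rw [AffineEquiv.apply_symm_apply, norm_smul, hx, Real.norm_of_nonneg hr.le, mul_one, hrk]
    ring
end
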